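/- Fix α ∈ (0,∞) and β > 0. Suppose ρ, ρ₁, ρ₂, … are Borel probability measures on (−1,1) such that ρᵢ → ρ weakly, ∫ arctanh(x)² ρ(dx) ≤ α, and ∫ arctanh(x)² ρᵢ(dx) ≤ α for all i. Then A(ρᵢ) → A(ρ) and E(ρᵢ) → E(ρ). -/

import Mathlib

open MeasureTheory ProbabilityTheory Real Filter
open scoped ENNReal NNReal

noncomputable section

/-- The open interval `(−1,1)` as a type. -/
abbrev Int11 : Type := ↥(Set.Ioo (-1 : ℝ) 1)

/-- Inverse hyperbolic tangent. -/
def atanh (x : ℝ) : ℝ := Real.log ((1 + x) / (1 - x)) / 2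

/-- Binary entropy function. -/
def ent (m : ℝ) : ℝ :=
  -((1 + m) / 2) * Real.log ((1 + m) / 2) - ((1 - m) / 2) * Real.log ((1 - m) / 2)

/-- `Q(ρ) = ∫ x² ρ(dx)`. -/
def Qm (ρ : ProbabilityMeasure Int11) : ℝ := ∫ x, (x : ℝ) ^ 2 ∂(ρ : Measure Int11)

/-- `A(ρ) = ∫ x arctanh(x) ρ(dx)`. -/
def Am (ρ : ProbabilityMeasure Int11) : ℝ :=
  ∫ x, (x : ℝ) * atanh (x : ℝ) ∂(ρ : Measure Int11)

/-- `E(ρ) = −∫ [h(x) + (1/2)x arctanh(x)] ρ(dx) − (β²/4)(1 − Q(ρ)²)`. -/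
def Em (β : ℝ) (ρ : ProbabilityMeasure Int11) : ℝ :=
  -∫ x, (ent (x : ℝ) + (x : ℝ) * atanh (x : ℝ) / 2) ∂(ρ : Measure Int11)
    - β ^ 2 / 4 * (1 - (Qm ρ) ^ 2)

/-- A continuous real function whose second moment is finite is square integrable. -/
theorem memLp_two_of_lintegral_sq_le {Ω : Type*} [TopologicalSpace Ω] [MeasurableSpace Ω]
    [OpensMeasurableSpace Ω] {f : Ω → ℝ} (hf : Continuous f) {α : ℝ} {μ : Measure Ω}
    (hμ : ∫⁻ x, ENNReal.ofReal (f x ^ 2) ∂μ ≤ ENNReal.ofReal α) : MemLp f 2 μ := by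
  refine (memLp_two_iff_integrable_sq hf.measurable.aestronglyMeasurable).2
    ⟨(hf.pow 2).measurable.aestronglyMeasurable, ?_⟩
  rw [hasFiniteIntegral_iff_ofReal (ae_of_all _ fun x => sq_nonneg (f x))]
  exact hμ.trans_lt ENNReal.ofReal_lt_top

/-- The truncation of `f` at height `R`, as a bounded continuous function. -/
def truncBCF {Ω : Type*} [TopologicalSpace Ω] (f : Ω → ℝ) (hf : Continuous f) (R : ℝ)
    (hR : 0 ≤ R) : BoundedContinuousFunction Ω ℝ :=
  BoundedContinuousFunction.ofNormedAddCommGroup (fun x => max (-R) (min R (f x)))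
    (by fun_prop) R (fun x => by
      rw [Real.norm_eq_abs, abs_le]
      exact ⟨le_max_left _ _, max_le (by linarith) (min_le_left _ _)⟩)

theorem mul_abs_sub_trunc_le_sq (R y : ℝ) (hR : 0 ≤ R) :
    R * |y - max (-R) (min R y)| ≤ y ^ 2 := by
  rcases le_total R y with h | h
  · rw [min_eq_left h, max_eq_right (by linarith), abs_of_nonneg (by linarith)]
    nlinarith
  · rw [min_eq_right h]
    rcases le_total (-R) y with h' | h'
    · rw [max_eq_right h', sub_self, abs_zero, mul_zero]
      positivity
    · rw [max_eq_left h', abs_of_nonpos (by linarith)]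
      nlinarith

theorem abs_integral_sub_integral_truncBCF_le {Ω : Type*} [TopologicalSpace Ω]
    [MeasurableSpace Ω] [OpensMeasurableSpace Ω] {f : Ω → ℝ} (hf : Continuous f) {α : ℝ}
    (hα : 0 ≤ α) {μ : Measure Ω} [IsProbabilityMeasure μ]
    (hμ : ∫⁻ x, ENNReal.ofReal (f x ^ 2) ∂μ ≤ ENNReal.ofReal α) {R : ℝ} (hR : 0 < R) :
    |∫ x, f x ∂μ - ∫ x, truncBCF f hf R hR.le x ∂μ| ≤ α / R := by
  have hL := memLp_two_of_lintegral_sq_le hf hμ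
  have hsq := hL.integrable_sq
  have hint : Integrable f μ := hL.integrable one_le_two
  have hle : ∫ x, f x ^ 2 ∂μ ≤ α := by
    rw [integral_eq_lintegral_of_nonneg_ae (ae_of_all _ fun x => sq_nonneg (f x))
      hsq.aestronglyMeasurable]
    exact ENNReal.toReal_le_of_le_ofReal hα hμ
  rw [← integral_sub hint (BoundedContinuousFunction.integrable μ _)]
  calc |∫ x, (f x - truncBCF f hf R hR.le x) ∂μ|
      ≤ ∫ x, |f x - truncBCF f hf R hR.le x| ∂μ := abs_integral_le_integral_abs
    _ ≤ ∫ x, f x ^ 2 / R ∂μ := by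
        refine integral_mono (hint.sub (BoundedContinuousFunction.integrable μ _)).abs
          (hsq.div_const R) fun x => ?_
        rw [le_div_iff₀ hR, mul_comm]
        exact mul_abs_sub_trunc_le_sq R (f x) hR.le
    _ = (∫ x, f x ^ 2 ∂μ) / R := integral_div R _
    _ ≤ α / R := by gcongr

/-- Under weak convergence, integrals of a continuous function with uniformly bounded second
moments converge. -/
theorem tendsto_integral_of_lintegral_sq_le {Ω ι : Type*} [TopologicalSpace Ω]
    [MeasurableSpace Ω] [OpensMeasurableSpace Ω] {l : Filter ι} {f : Ω → ℝ}
    (hf : Continuous f) {α : ℝ} (hα : 0 ≤ α) {μ : ProbabilityMeasure Ω}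
    {μs : ι → ProbabilityMeasure Ω} (hconv : Tendsto μs l (nhds μ))
    (hμ : ∫⁻ x, ENNReal.ofReal (f x ^ 2) ∂(μ : Measure Ω) ≤ ENNReal.ofReal α)
    (hμs : ∀ i, ∫⁻ x, ENNReal.ofReal (f x ^ 2) ∂(μs i : Measure Ω) ≤ ENNReal.ofReal α) :
    Tendsto (fun i => ∫ x, f x ∂(μs i : Measure Ω)) l (nhds (∫ x, f x ∂(μ : Measure Ω))) := by
  rw [Metric.tendsto_nhds]
  intro ε hε
  have hR : 0 < 3 * (α + 1) / ε := by positivity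
  have hsmall : α / (3 * (α + 1) / ε) < ε / 3 := by
    rw [div_div_eq_mul_div, div_lt_div_iff₀ (by positivity) (by norm_num)]
    nlinarith
  filter_upwards [Metric.tendsto_nhds.1
    (ProbabilityMeasure.tendsto_iff_forall_integral_tendsto.1 hconv
      (truncBCF f hf _ hR.le)) (ε / 3) (by positivity)] with i hi
  have h₁ := abs_integral_sub_integral_truncBCF_le hf hα (hμs i) hR
  have h₂ := abs_integral_sub_integral_truncBCF_le hf hα hμ hR
  rw [Real.dist_eq] at hi ⊢
  rw [abs_le] at h₁ h₂
  rw [abs_lt] at hi ⊢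
  constructor <;> linarith [h₁.1, h₁.2, h₂.1, h₂.2, hi.1, hi.2]

theorem ent_eq_binEntropy (m : ℝ) : ent m = binEntropy ((1 + m) / 2) := by
  rw [ent, binEntropy, Real.log_inv, Real.log_inv, show 1 - (1 + m) / 2 = (1 - m) / 2 by ring]
  ring

/-- The binary entropy as a bounded continuous function on `(-1,1)`. -/
def entBCF : BoundedContinuousFunction Int11 ℝ :=
  BoundedContinuousFunction.ofNormedAddCommGroup (fun x => ent x)
    (by simp only [ent_eq_binEntropy]; fun_prop) (Real.log 2) (fun x => by
      obtain ⟨h₁, h₂⟩ := x.2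
      rw [ent_eq_binEntropy, Real.norm_eq_abs,
        abs_of_nonneg (binEntropy_nonneg (by linarith) (by linarith))]
      exact binEntropy_le_log_two)

/-- `x ↦ x²` as a bounded continuous function on `(-1,1)`. -/
def sqBCF : BoundedContinuousFunction Int11 ℝ :=
  BoundedContinuousFunction.ofNormedAddCommGroup (fun x => (x : ℝ) ^ 2) (by fun_prop) 1
    (fun x => by
      obtain ⟨h₁, h₂⟩ := x.2
      rw [Real.norm_eq_abs, abs_of_nonneg (sq_nonneg _)]
      nlinarith)

theorem continuous_mul_atanh : Continuous fun x : Int11 => (x : ℝ) * atanh x := by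
  have h₁ (x : Int11) : 1 - (x : ℝ) ≠ 0 := by linarith [x.2.2]
  have h₂ (x : Int11) : (1 + (x : ℝ)) / (1 - x) ≠ 0 :=
    div_ne_zero (by linarith [x.2.1]) (h₁ x)
  unfold atanh
  fun_prop (disch := assumption)

theorem lintegral_sq_mul_atanh_le (μ : Measure Int11) :
    ∫⁻ x, ENNReal.ofReal (((x : ℝ) * atanh x) ^ 2) ∂μ
      ≤ ∫⁻ x, ENNReal.ofReal (atanh (x : ℝ) ^ 2) ∂μ := by
  refine lintegral_mono fun x => ENNReal.ofReal_le_ofReal ?_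
  obtain ⟨h₁, h₂⟩ := x.2
  rw [mul_pow]
  exact mul_le_of_le_one_left (sq_nonneg _) (by nlinarith)

theorem Em_eq (β : ℝ) {α : ℝ} (μ : ProbabilityMeasure Int11)
    (hμ : ∫⁻ x, ENNReal.ofReal (atanh (x : ℝ) ^ 2) ∂(μ : Measure Int11) ≤ ENNReal.ofReal α) :
    Em β μ = -(∫ x, ent (x : ℝ) ∂(μ : Measure Int11) + Am μ / 2)
      - β ^ 2 / 4 * (1 - Qm μ ^ 2) := by
  have hint : Integrable (fun x : Int11 => (x : ℝ) * atanh x) (μ : Measure Int11) :=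
    (memLp_two_of_lintegral_sq_le continuous_mul_atanh
      ((lintegral_sq_mul_atanh_le _).trans hμ)).integrable one_le_two
  have hent : Integrable (fun x : Int11 => ent x) (μ : Measure Int11) :=
    BoundedContinuousFunction.integrable (μ : Measure Int11) entBCF
  rw [Em, integral_add hent (hint.div_const 2), integral_div, Am]

/-- **Lemma B.3.** If `ρᵢ → ρ` weakly and `∫ arctanh(x)² dρᵢ ≤ α`,
`∫ arctanh(x)² dρ ≤ α`, then `A(ρᵢ) → A(ρ)` and `E(ρᵢ) → E(ρ)`. -/
theorem A_and_E_continuous (α β : ℝ) (hα : 0 < α) (hβ : 0 < β)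
    (ρ : ProbabilityMeasure Int11) (ρs : ℕ → ProbabilityMeasure Int11)
    (hconv : Tendsto ρs atTop (nhds ρ))
    (hρ : (∫⁻ x, ENNReal.ofReal ((atanh (x : ℝ)) ^ 2) ∂(ρ : Measure Int11))
      ≤ ENNReal.ofReal α)
    (hρs : ∀ i, (∫⁻ x, ENNReal.ofReal ((atanh (x : ℝ)) ^ 2) ∂(ρs i : Measure Int11))
      ≤ ENNReal.ofReal α) :
    Tendsto (fun i => Am (ρs i)) atTop (nhds (Am ρ)) ∧
    Tendsto (fun i => Em β (ρs i)) atTop (nhds (Em β ρ)) := by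
  have hA : Tendsto (fun i => Am (ρs i)) atTop (nhds (Am ρ)) :=
    tendsto_integral_of_lintegral_sq_le continuous_mul_atanh hα.le hconv
      ((lintegral_sq_mul_atanh_le _).trans hρ)
      fun i => (lintegral_sq_mul_atanh_le _).trans (hρs i)
  have hbounded := ProbabilityMeasure.tendsto_iff_forall_integral_tendsto.1 hconv
  have hQ : Tendsto (fun i => Qm (ρs i)) atTop (nhds (Qm ρ)) := hbounded sqBCF
  have hent : Tendsto (fun i => ∫ x, ent (x : ℝ) ∂(ρs i : Measure Int11)) atTop
      (nhds (∫ x, ent (x : ℝ) ∂(ρ : Measure Int11))) := hbounded entBCF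
  refine ⟨hA, ?_⟩
  rw [Em_eq β ρ hρ]
  simp only [fun i => Em_eq β (ρs i) (hρs i)]
  exact (hent.add (hA.div_const 2)).neg.sub (((hQ.pow 2).const_sub 1).const_mul _)

end
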